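/- (Contraction Lemma) With the fixed-pair setup in a diregular (2,k,+3)-digraph with k ≥ 3: let w ∈ T_{k-1}(v₁) with d(v₁,w) = l, and suppose w ∈ T_{k-1}(u₁) with d(u₁,w) = m. Then either m ≤ l or w ∈ N^{k-1}(u₁) (i.e. m = k−1). The symmetric statement holds with the roles of u₁ and v₁ exchanged. -/

import Mathlib

/-- `p` is a directed walk from `u` to `v` in the digraph with arc relation `A`,
recorded as the list of its vertices; a walk of length `l` (i.e. with `l` arcs)
is a list of `l + 1` vertices. -/
def IsWalkFrom {V : Type*} (A : V → V → Prop) (u v : V) (p : List V) : Prop :=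
  p.Chain' A ∧ p.head? = some u ∧ p.getLast? = some v

/-- A digraph is `k`-geodetic if for every ordered pair of vertices `(u, v)`
there is at most one directed path of length at most `k` from `u` to `v`. -/
def IsKGeodetic {V : Type*} (A : V → V → Prop) (k : ℕ) : Prop :=
  ∀ (u v : V) (p q : List V), IsWalkFrom A u v p → IsWalkFrom A u v q →
    p.length ≤ k + 1 → q.length ≤ k + 1 → p = q

/-- `Nout A u = N⁺(u)`, the set of out-neighbours of `u`. -/
def Nout {V : Type*} (A : V → V → Prop) (u : V) : Set V := {v | A u v}

/-- `Nin A u = N⁻(u)`, the set of in-neighbours of `u`. -/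
def Nin {V : Type*} (A : V → V → Prop) (u : V) : Set V := {v | A v u}

/-- `NIter A l u = N^l(u)`, the set of vertices reachable from `u` by a
directed path of length exactly `l`. -/
def NIter {V : Type*} (A : V → V → Prop) (l : ℕ) (u : V) : Set V :=
  {v | ∃ p : List V, IsWalkFrom A u v p ∧ p.length = l + 1}

/-- `Ball A l u = T_l(u) = N^0(u) ∪ N^1(u) ∪ ⋯ ∪ N^l(u)`, the set of vertices
at distance at most `l` from `u`. -/
def Ball {V : Type*} (A : V → V → Prop) (l : ℕ) (u : V) : Set V :=
  {v | ∃ m ≤ l, v ∈ NIter A m u}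

/-- `Outliers A k u = O(u) = {v | d(u,v) ≥ k + 1}`, the outlier set of `u`. -/
def Outliers {V : Type*} (A : V → V → Prop) (k : ℕ) (u : V) : Set V :=
  {v | v ∉ Ball A k u}

/-- A digraph is diregular with degree `d` if every vertex has out-degree `d`
and in-degree `d`. -/
def IsDiregular {V : Type*} (A : V → V → Prop) (d : ℕ) : Prop :=
  ∀ u : V, (Nout A u).ncard = d ∧ (Nin A u).ncard = d

/-- The Moore bound `M(d,k) = 1 + d + d² + ⋯ + d^k`. -/
def moore (d k : ℕ) : ℕ := ∑ i ∈ Finset.range (k + 1), d ^ i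

section Geodetic

variable {V : Type*} {A : V → V → Prop} {k : ℕ}

theorem isWalkFrom_singleton (u : V) : IsWalkFrom A u u [u] :=
  ⟨List.isChain_singleton u, rfl, rfl⟩

theorem IsWalkFrom.cons {u x v : V} {p : List V} (h : A u x) (hp : IsWalkFrom A x v p) :
    IsWalkFrom A u v (u :: p) := by
  obtain ⟨hc, hh, hl⟩ := hp
  cases p with
  | nil => simp at hh
  | cons y p =>
    obtain rfl : y = x := by simpa using hh
    exact ⟨List.IsChain.cons_cons h hc, rfl, by simpa using hl⟩

theorem mem_NIter_zero {u v : V} : v ∈ NIter A 0 u ↔ v = u := by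
  constructor
  · rintro ⟨p, ⟨-, hh, hl⟩, hlen⟩
    obtain ⟨x, rfl⟩ := List.length_eq_one_iff.1 hlen
    simp at hh hl
    exact hl.symm.trans hh
  · rintro rfl
    exact ⟨[v], isWalkFrom_singleton v, rfl⟩

theorem mem_NIter_succ {l : ℕ} {u v : V} :
    v ∈ NIter A (l + 1) u ↔ ∃ x, A u x ∧ v ∈ NIter A l x := by
  constructor
  · rintro ⟨p, ⟨hc, hh, hl⟩, hlen⟩
    match p, hlen with
    | y :: x :: p, hlen =>
      obtain rfl : y = u := by simpa using hh
      obtain ⟨hyx, hc⟩ := List.isChain_cons_cons.1 hc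
      exact ⟨x, hyx, x :: p, ⟨hc, rfl, by simpa using hl⟩, by simpa using hlen⟩
  · rintro ⟨x, hux, p, hp, hlen⟩
    exact ⟨u :: p, hp.cons hux, by simp [hlen]⟩

theorem mem_NIter_one {u v : V} : v ∈ NIter A 1 u ↔ A u v := by
  simp [mem_NIter_succ (l := 0), mem_NIter_zero]

theorem NIter_trans {a b : ℕ} {u x v : V} (h₁ : x ∈ NIter A a u) (h₂ : v ∈ NIter A b x) :
    v ∈ NIter A (a + b) u := by
  induction a generalizing u with
  | zero =>
    rw [mem_NIter_zero.1 h₁] at h₂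
    simpa using h₂
  | succ a ih =>
    obtain ⟨y, huy, hy⟩ := mem_NIter_succ.1 h₁
    rw [Nat.add_right_comm]
    exact mem_NIter_succ.2 ⟨y, huy, ih hy⟩

theorem IsKGeodetic.length_eq (hgeo : IsKGeodetic A k) {a b : ℕ} {u v : V} (ha : a ≤ k)
    (hb : b ≤ k) (h₁ : v ∈ NIter A a u) (h₂ : v ∈ NIter A b u) : a = b := by
  obtain ⟨p, hp, hpl⟩ := h₁
  obtain ⟨q, hq, hql⟩ := h₂
  have := hgeo u v p q hp hq (by omega) (by omega)
  subst this
  omega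

theorem IsKGeodetic.outNeighbour_eq (hgeo : IsKGeodetic A k) {a b : ℕ} {u x y v : V}
    (ha : a + 1 ≤ k) (hb : b + 1 ≤ k) (hx : A u x) (hy : A u y)
    (h₁ : v ∈ NIter A a x) (h₂ : v ∈ NIter A b y) : x = y := by
  obtain ⟨p, hp, hpl⟩ := h₁
  obtain ⟨q, hq, hql⟩ := h₂
  have := hgeo u v _ _ (hp.cons hx) (hq.cons hy) (by simp; omega) (by simp; omega)
  obtain rfl : p = q := by simpa using this
  exact Option.some_injective _ (hp.2.1.symm.trans hq.2.1)

theorem mem_insert_Outliers {u u₁ u₂ : V} (hu : Nout A u = {u₁, u₂}) (hk : 1 ≤ k) {x : V}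
    (h₁ : x ∉ Ball A (k - 1) u₁) (h₂ : x ∉ Ball A (k - 1) u₂) :
    x ∈ insert u (Outliers A k u) := by
  by_contra hx
  simp only [Set.mem_insert_iff, Outliers, Set.mem_ofPred_eq, not_or, not_not] at hx
  obtain ⟨hxu, m, hm, hx⟩ := hx
  cases m with
  | zero => exact hxu (mem_NIter_zero.1 hx)
  | succ m =>
    obtain ⟨y, huy, hy⟩ := mem_NIter_succ.1 hx
    have : y ∈ Nout A u := huy
    rw [hu] at this
    obtain rfl | rfl := this
    · exact h₁ ⟨m, by omega, hy⟩
    · exact h₂ ⟨m, by omega, hy⟩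

variable [Fintype V]

theorem ncard_NIter (hgeo : IsKGeodetic A k) (hreg : IsDiregular A 2) {j : ℕ} (hj : j ≤ k)
    (u : V) : (NIter A j u).ncard = 2 ^ j := by
  induction j generalizing u with
  | zero =>
    rw [show NIter A 0 u = {u} from Set.ext fun _ => mem_NIter_zero]
    simp
  | succ j ih =>
    obtain ⟨x, y, hxy, hu⟩ := Set.ncard_eq_two.1 (hreg u).1
    have hA (z : V) : A u z ↔ z = x ∨ z = y := by
      change z ∈ Nout A u ↔ _
      simp [hu]
    have hunion : NIter A (j + 1) u = NIter A j x ∪ NIter A j y := by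
      ext v
      simp [mem_NIter_succ, hA, or_and_right, exists_or]
    have hdisj : Disjoint (NIter A j x) (NIter A j y) :=
      Set.disjoint_left.2 fun v h₁ h₂ => hxy <|
        hgeo.outNeighbour_eq hj hj ((hA x).2 (.inl rfl)) ((hA y).2 (.inr rfl)) h₁ h₂
    rw [hunion, Set.ncard_union_eq hdisj, ih (by omega), ih (by omega), pow_succ]
    omega

theorem ncard_Ball (hgeo : IsKGeodetic A k) (hreg : IsDiregular A 2) {j : ℕ} (hj : j ≤ k)
    (u : V) : (Ball A j u).ncard = moore 2 j := by
  induction j with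
  | zero =>
    rw [show Ball A 0 u = {u} by ext v; simp [Ball, mem_NIter_zero]]
    simp [moore]
  | succ j ih =>
    have hunion : Ball A (j + 1) u = Ball A j u ∪ NIter A (j + 1) u := by
      ext v
      simp [Ball, Nat.le_succ_iff, or_and_right, exists_or]
    have hdisj : Disjoint (Ball A j u) (NIter A (j + 1) u) := by
      refine Set.disjoint_left.2 ?_
      rintro v ⟨m, hm, h₁⟩ h₂
      have := hgeo.length_eq (by omega) hj h₁ h₂
      omega
    rw [hunion, Set.ncard_union_eq hdisj, ih (by omega), ncard_NIter hgeo hreg hj]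
    exact (Finset.sum_range_succ _ (j + 1)).symm

theorem ncard_Outliers (hgeo : IsKGeodetic A k) (hreg : IsDiregular A 2) {ε : ℕ}
    (hcard : Fintype.card V = moore 2 k + ε) (u : V) : (Outliers A k u).ncard = ε := by
  have h := Set.ncard_add_ncard_compl (Ball A k u)
  rw [ncard_Ball hgeo hreg le_rfl, Nat.card_eq_fintype_card, hcard] at h
  exact Nat.add_left_cancel h

section FixedPair

variable {u v u₁ u₂ v₁ : V}

/-- A vertex violating the contraction property lies exactly one level above the bottom of
`T_{k-1}(u₁)`, and its second out-neighbourhood consists of `u` and the outliers of `u`. -/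
theorem NIter_two_eq_of_lt (hreg : IsDiregular A 2) (hgeo : IsKGeodetic A k)
    (hcard : Fintype.card V = moore 2 k + 3)
    (hu : Nout A u = {u₁, u₂}) (hv₁ : A v v₁) (hv₂ : A v u₂) (hne : v₁ ≠ u₂)
    {w : V} {l m : ℕ} (hlm : l < m) (hm : m < k - 1)
    (hl : w ∈ NIter A l v₁) (hw : w ∈ NIter A m u₁) :
    m + 2 = k ∧ l + 3 = k ∧ NIter A 2 w = insert u (Outliers A k u) := by
  have hsub : NIter A (k - m) w ⊆ insert u (Outliers A k u) := by
    intro x hx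
    refine mem_insert_Outliers hu (by omega) ?_ ?_
    · rintro ⟨i, hi, hxi⟩
      have := hgeo.length_eq (by omega) (by omega) hxi (NIter_trans hw hx)
      omega
    · rintro ⟨i, hi, hxi⟩
      exact hne (hgeo.outNeighbour_eq (by omega) (by omega) hv₁ hv₂ (NIter_trans hl hx) hxi)
  have hle : (insert u (Outliers A k u)).ncard ≤ 4 := by
    simpa [ncard_Outliers hgeo hreg hcard u] using Set.ncard_insert_le u (Outliers A k u)
  have hcard_le := (Set.ncard_le_ncard hsub).trans hle
  rw [ncard_NIter hgeo hreg (by omega)] at hcard_le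
  have hkm : k - m ≤ 2 := (Nat.pow_le_pow_iff_right (a := 2) (by norm_num)).1 hcard_le
  have hkm : k - m = 2 := by omega
  rw [hkm] at hsub
  have heq : NIter A 2 w = insert u (Outliers A k u) :=
    Set.eq_of_subset_of_ncard_le hsub (by rwa [ncard_NIter hgeo hreg (by omega)])
  refine ⟨by omega, ?_, heq⟩
  by_contra hlk
  have huw : u ∈ NIter A 2 w := heq ▸ Set.mem_insert _ _
  have huu₂ : u₂ ∈ NIter A 1 u := mem_NIter_one.2 (hu.symm ▸ Or.inr rfl : u₂ ∈ Nout A u)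
  exact hne <| hgeo.outNeighbour_eq (b := 0) (by omega) (by omega) hv₁ hv₂
    (NIter_trans (NIter_trans hl huw) huu₂) (mem_NIter_zero.2 rfl)

theorem contraction_of_fixedPair (hreg : IsDiregular A 2) (hgeo : IsKGeodetic A k)
    (hcard : Fintype.card V = moore 2 k + 3)
    (hu : Nout A u = {u₁, u₂}) (hv : Nout A v = {v₁, u₂}) (huv : u₁ ≠ v₁)
    {w : V} {l m : ℕ} (hm : m ≤ k - 1)
    (hl : w ∈ NIter A l v₁) (hw : w ∈ NIter A m u₁) :
    m ≤ l ∨ w ∈ NIter A (k - 1) u₁ := by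
  by_contra! hcon
  obtain ⟨hlm, hwk⟩ := hcon
  have hmk : m < k - 1 := lt_of_le_of_ne hm fun h => hwk (h ▸ hw)
  have hu₁ : A u u₁ := (hu.symm ▸ Or.inl rfl : u₁ ∈ Nout A u)
  have hu₂ : A u u₂ := (hu.symm ▸ Or.inr rfl : u₂ ∈ Nout A u)
  have hv₁ : A v v₁ := (hv.symm ▸ Or.inl rfl : v₁ ∈ Nout A v)
  have hv₂ : A v u₂ := (hv.symm ▸ Or.inr rfl : u₂ ∈ Nout A v)
  have hne : v₁ ≠ u₂ := by
    rintro rfl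
    have := (hreg v).1
    simp [hv] at this
  obtain ⟨-, hlk, hN⟩ := NIter_two_eq_of_lt hreg hgeo hcard hu hv₁ hv₂ hne hlm hmk hl hw
  have hball {x : V} {j : ℕ} (hj : j ≤ k - 2) (hx : x ∈ NIter A j v₁) :
      x ∈ Ball A (k - 1) u₁ := by
    by_contra hxu
    have hxO : x ∈ insert u (Outliers A k u) := by
      refine mem_insert_Outliers hu (by omega) hxu ?_
      rintro ⟨i, hi, hxi⟩
      exact hne (hgeo.outNeighbour_eq (by omega) (by omega) hv₁ hv₂ hx hxi)
    rw [← hN] at hxO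
    have := hgeo.length_eq (by omega) (by omega) hx (NIter_trans hl hxO)
    omega
  obtain ⟨p, hp, hv₁p⟩ := hball (Nat.zero_le _) (mem_NIter_zero.2 rfl)
  have hp₀ : p ≠ 0 := by
    rintro rfl
    exact huv (mem_NIter_zero.1 hv₁p).symm
  have hpk : p < k - 1 := by
    obtain ⟨y, _, -, hy⟩ := Set.ncard_eq_two.1 (hreg v₁).1
    have hy : y ∈ NIter A 1 v₁ := mem_NIter_one.2 (hy.symm ▸ Or.inl rfl : y ∈ Nout A v₁)
    obtain ⟨q, hq, hyq⟩ := hball (by omega) hy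
    have := hgeo.length_eq (by omega) (by omega) hyq (NIter_trans hv₁p hy)
    omega
  obtain ⟨hpk', hk3, hN'⟩ := NIter_two_eq_of_lt hreg hgeo hcard hu hv₁ hv₂ hne
    (Nat.pos_of_ne_zero hp₀) hpk (mem_NIter_zero.2 rfl) hv₁p
  have hself : v ∈ NIter A 0 v := mem_NIter_zero.2 rfl
  have hvO : v ∈ insert u (Outliers A k u) := by
    refine mem_insert_Outliers hu (by omega) ?_ ?_
    · rintro ⟨i, hi, hvi⟩
      have := hgeo.length_eq (by omega) (by omega) hv₁p
        (NIter_trans hvi (mem_NIter_one.2 hv₁))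
      obtain rfl : i = 0 := by omega
      rw [mem_NIter_zero.1 hvi] at hv₂
      have := hgeo.length_eq (by omega) (by omega) (mem_NIter_one.2 hu₂)
        (NIter_trans (mem_NIter_one.2 hu₁) (mem_NIter_one.2 hv₂))
      omega
    · rintro ⟨i, hi, hvi⟩
      have := hgeo.length_eq (by omega) (by omega) hself
        (NIter_trans (mem_NIter_one.2 hv₂) hvi)
      omega
  rw [← hN'] at hvO
  have := hgeo.length_eq (by omega) (by omega) hself
    (NIter_trans (mem_NIter_one.2 hv₁) hvO)
  omega

end FixedPair

end Geodetic

/-- **Contraction Lemma.**  Fixed-pair setup, `k ≥ 3`: if `w ∈ T_{k-1}(v₁)`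
with `d(v₁,w) = l` and `w ∈ T_{k-1}(u₁)` with `d(u₁,w) = m`, then `m ≤ l`
or `w ∈ N^{k-1}(u₁)`; symmetrically with the roles of `u₁` and `v₁`
exchanged. -/
theorem contraction_lemma {V : Type*} [Fintype V] (A : V → V → Prop) (k : ℕ)
    (u v u₁ u₂ v₁ : V)
    (hirr : Irreflexive A) (hreg : IsDiregular A 2) (hgeo : IsKGeodetic A k)
    (hcard : Fintype.card V = moore 2 k + 3)
    (hu : Nout A u = {u₁, u₂}) (hv : Nout A v = {v₁, u₂}) (huv : u₁ ≠ v₁)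
    (hk : 3 ≤ k) :
    (∀ (w : V) (l m : ℕ), l ≤ k - 1 → m ≤ k - 1 →
        w ∈ NIter A l v₁ → w ∈ NIter A m u₁ →
        m ≤ l ∨ w ∈ NIter A (k - 1) u₁) ∧
      (∀ (w : V) (l m : ℕ), l ≤ k - 1 → m ≤ k - 1 →
        w ∈ NIter A l u₁ → w ∈ NIter A m v₁ →
        m ≤ l ∨ w ∈ NIter A (k - 1) v₁) := by
  exact ⟨fun _ _ _ _ hm hl hw => contraction_of_fixedPair hreg hgeo hcard hu hv huv hm hl hw,
    fun _ _ _ _ hm hl hw => contraction_of_fixedPair hreg hgeo hcard hv hu huv.symm hm hl hw⟩
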